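/- Let n ≥ 4 and d = n+3. For every pair of nonnegative integers (u,v) with u+v = n−2 and u > 0, the couple (Σ_{2,n,2},(u,v,3)) is non-realizable: no hyperbolic polynomial of degree d realizes it. -/

import Mathlib

open Polynomial Finset

/-- A real polynomial `P` of degree `d` defines the sign pattern `Σ_{m,n,q}`:
reading the coefficients from that of `x^d` down to the constant term, the first
`m` are positive, the next `n` are negative and the last `q` are positive
(in particular all `d+1` coefficients are nonzero), where `m + n + q = d + 1`. -/
def SignPatternMNQ (P : Polynomial ℝ) (d m n q : ℕ) : Prop :=
  m + n + q = d + 1 ∧ 0 < m ∧ 0 < n ∧ 0 < q ∧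
  (∀ k, k ≤ d → (d - k < m ∨ m + n ≤ d - k) → 0 < P.coeff k) ∧
  (∀ k, k ≤ d → (m ≤ d - k ∧ d - k < m + n) → P.coeff k < 0)

/-- The couple `(Σ_{m,n,q}, (u,v,w))` is realizable (in degree `d`): there is a
hyperbolic polynomial `P` of degree `d` defining the sign pattern `Σ_{m,n,q}`,
whose roots are exactly two positive numbers `β < α` together with `d - 2`
negative numbers `-γ i`, all moduli being distinct, such that exactly `u` of
the `γ i` are `< β`, exactly `v` lie in `(β, α)` and exactly `w` are `> α`. -/
def RealizesCouple (d m n q u v w : ℕ) : Prop :=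
  ∃ (P : Polynomial ℝ) (α β : ℝ) (γ : Fin (d - 2) → ℝ),
    P.natDegree = d ∧
    SignPatternMNQ P d m n q ∧
    0 < β ∧ β < α ∧
    StrictMono γ ∧ (∀ i, 0 < γ i) ∧ (∀ i, γ i ≠ β ∧ γ i ≠ α) ∧
    P.roots = (α ::ₘ β ::ₘ Multiset.map (fun i => -γ i) Finset.univ.val) ∧
    (Finset.univ.filter (fun i => γ i < β)).card = u ∧
    (Finset.univ.filter (fun i => β < γ i ∧ γ i < α)).card = v ∧
    (Finset.univ.filter (fun i => α < γ i)).card = w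

/-- Twice the second elementary symmetric function, in terms of power sums. -/
theorem two_mul_esymm_two (s : Multiset ℝ) :
    2 * s.esymm 2 = s.sum ^ 2 - (s.map (· ^ 2)).sum := by
  induction s using Multiset.induction_on with
  | empty => simp [Multiset.esymm, Multiset.powersetCard_zero_right]
  | cons a s ih =>
    have h : (a ::ₘ s).esymm 2 = s.esymm 2 + a * s.sum := by
      simpa [Multiset.esymm, Multiset.powersetCard_cons, Multiset.powersetCard_one,
        Multiset.map_map] using Multiset.sum_map_mul_left (s := s) (a := a) (f := id)
    rw [h, mul_add, ih]
    simp only [Multiset.sum_cons, Multiset.map_cons]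
    ring

/-- The three lowest coefficients of a product of linear factors with nonzero roots. -/
theorem coeff_prod_X_sub_C_low (s : Multiset ℝ) (hs : ∀ r ∈ s, r ≠ 0) :
    ((s.map (fun r => X - C r)).prod.coeff 1 =
        -((s.map (fun r => X - C r)).prod.coeff 0 * (s.map (·⁻¹)).sum)) ∧
      2 * (s.map (fun r => X - C r)).prod.coeff 2 =
        (s.map (fun r => X - C r)).prod.coeff 0 *
          ((s.map (·⁻¹)).sum ^ 2 - (s.map (·⁻¹ ^ 2)).sum) := by
  induction s using Multiset.induction_on with
  | empty => simp [coeff_one]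
  | cons a s ih =>
    obtain ⟨h1, h2⟩ := ih fun r hr => hs r (Multiset.mem_cons_of_mem hr)
    have ha : a ≠ 0 := hs a (Multiset.mem_cons_self a s)
    simp only [Multiset.map_cons, Multiset.prod_cons, Multiset.sum_cons]
    set Q := (s.map (fun r => X - C r)).prod
    have k0 : ((X - C a) * Q).coeff 0 = -(a * Q.coeff 0) := by
      simp [sub_mul]
    have k1 : ((X - C a) * Q).coeff 1 = Q.coeff 0 - a * Q.coeff 1 := by
      simp [sub_mul, coeff_X_mul Q 0]
    have k2 : ((X - C a) * Q).coeff 2 = Q.coeff 1 - a * Q.coeff 2 := by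
      simp [sub_mul, coeff_X_mul Q 1]
    rw [k0, k1, k2]
    constructor
    · rw [h1]; field_simp; ring
    · rw [mul_sub, mul_left_comm, h2, h1]; field_simp; ring

/-- If all coefficients of degrees `d`, `d - 2`, `0`, `2` have the signs `+, -, +, -`, then both
the roots and their inverses satisfy `(∑ r) ^ 2 < ∑ r ^ 2`. -/
theorem roots_sum_sq_lt {P : ℝ[X]} {d : ℕ} (hd : P.natDegree = d) (hd2 : 2 ≤ d)
    (hcard : P.roots.card = d) (h0 : ∀ r ∈ P.roots, r ≠ 0)
    (ctop : 0 < P.coeff d) (csub : P.coeff (d - 2) < 0)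
    (czero : 0 < P.coeff 0) (ctwo : P.coeff 2 < 0) :
    P.roots.sum ^ 2 < (P.roots.map (· ^ 2)).sum ∧
      (P.roots.map (·⁻¹)).sum ^ 2 < (P.roots.map (·⁻¹ ^ 2)).sum := by
  have hroots : P.roots.card = P.natDegree := hcard.trans hd.symm
  have hlead : 0 < P.leadingCoeff := by rwa [leadingCoeff, hd]
  constructor
  · have hv := coeff_eq_esymm_roots_of_card hroots (k := d - 2) (by omega)
    rw [hd, show d - (d - 2) = 2 by omega] at hv
    have he : P.roots.esymm 2 < 0 := by
      by_contra! hcon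
      have := mul_nonneg hlead.le hcon
      rw [hv] at csub
      linarith
    linarith [two_mul_esymm_two P.roots]
  · have hfac := C_leadingCoeff_mul_prod_multiset_X_sub_C hroots
    obtain ⟨-, hlow⟩ := coeff_prod_X_sub_C_low P.roots h0
    set Q := (P.roots.map (fun r => X - C r)).prod
    rw [← hfac, coeff_C_mul] at czero ctwo
    have q0 : 0 < Q.coeff 0 := pos_of_mul_pos_right czero hlead.le
    have q2 : Q.coeff 2 < 0 := by
      by_contra! hcon
      linarith [mul_nonneg hlead.le hcon]
    by_contra! hcon
    linarith [mul_nonneg q0.le (sub_nonneg.2 hcon)]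

/-- Shrinking a family of nonnegative numbers preserves `(∑ r) ^ 2 < ∑ r ^ 2`. -/
theorem sq_lt_of_add_sum_sq_lt {ι : Type*} (T : Finset ι) (f : ι → ℝ) (hf : ∀ i ∈ T, 0 ≤ f i)
    {s q : ℝ} (hs : 0 ≤ s) (h : (s + ∑ i ∈ T, f i) ^ 2 < q + ∑ i ∈ T, f i ^ 2) :
    s ^ 2 < q := by
  have h1 : ∑ i ∈ T, f i ^ 2 ≤ (∑ i ∈ T, f i) ^ 2 := Finset.sum_sq_le_sq_sum_of_nonneg hf
  have h2 : 0 ≤ ∑ i ∈ T, f i := Finset.sum_nonneg hf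
  nlinarith [mul_nonneg hs h2]

/-- A positivity statement for three numbers greater than one. -/
theorem symmetric_pos {a b c : ℝ} (ha : 1 < a) (hb : 1 < b) (hc : 1 < c) :
    0 < (a * b + b * c + c * a) * (a * b * c) - 2 * (a + b + c) * (a * b * c)
      + (a + b + c) * (a + b + c - 1) := by
  obtain ⟨i, rfl⟩ : ∃ i, a = 1 + i := ⟨a - 1, by ring⟩
  obtain ⟨j, rfl⟩ : ∃ j, b = 1 + j := ⟨b - 1, by ring⟩
  obtain ⟨k, rfl⟩ : ∃ k, c = 1 + k := ⟨c - 1, by ring⟩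
  have hi : 0 < i := by linarith
  have hj : 0 < j := by linarith
  have hk : 0 < k := by linarith
  have e1 : 3 * (i * j + j * k + k * i) ≤ (i + j + k) ^ 2 := by
    nlinarith [sq_nonneg (i - j), sq_nonneg (j - k), sq_nonneg (k - i)]
  have e2 : 9 * (i * j * k) ≤ (i + j + k) * (i * j + j * k + k * i) := by
    nlinarith [mul_nonneg hi.le (sq_nonneg (j - k)), mul_nonneg hj.le (sq_nonneg (k - i)),
      mul_nonneg hk.le (sq_nonneg (i - j))]
  have e3 : 0 < i * j := by positivity
  have e4 : 0 < j * k := by positivity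
  have e5 : 0 < k * i := by positivity
  have e6 : 0 < i * j * k := by positivity
  have e7 : 0 < (i * j + j * k + k * i) * (i * j * k) := by positivity
  nlinarith [sq_nonneg (i * j + j * k + k * i)]

/-- The normalized obstruction: the two inequalities cannot hold together. -/
theorem normalized_obstruction {a b c x y β : ℝ} (ha : 1 < a) (hb : 1 < b) (hc : 1 < c)
    (hx : 0 < x) (hxβ : x < β) (hβ : β < 1) (hy : 0 < y) (hy1 : y < 1)
    (h1 : (a + b + c + x + y - 1 - β) ^ 2
      < a ^ 2 + b ^ 2 + c ^ 2 + x ^ 2 + y ^ 2 + 1 + β ^ 2)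
    (h2 : (a⁻¹ + b⁻¹ + c⁻¹ + x⁻¹ + y⁻¹ - 1 - β⁻¹) ^ 2
      < a⁻¹ ^ 2 + b⁻¹ ^ 2 + c⁻¹ ^ 2 + x⁻¹ ^ 2 + y⁻¹ ^ 2 + 1 + β⁻¹ ^ 2) : False := by
  have hβ0 : 0 < β := hx.trans hxβ
  have ha0 : 0 < a := by linarith
  have hb0 : 0 < b := by linarith
  have hc0 : 0 < c := by linarith
  obtain ⟨p, hp⟩ : ∃ p, p = β - (x + y) := ⟨_, rfl⟩
  obtain ⟨q, hq⟩ : ∃ q, q = β * (x + y) - x * y := ⟨_, rfl⟩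
  obtain ⟨m, hm⟩ : ∃ m, m = x * y * β := ⟨_, rfl⟩
  obtain ⟨σ, hσ⟩ : ∃ σ, σ = a + b + c := ⟨_, rfl⟩
  obtain ⟨τ, hτ⟩ : ∃ τ, τ = a * b + b * c + c * a := ⟨_, rfl⟩
  obtain ⟨π, hπ⟩ : ∃ π, π = a * b * c := ⟨_, rfl⟩
  have c1 : (τ - σ) - (σ - 1) * p - q < 0 := by
    rw [hp, hq, hσ, hτ]; linarith
  have c2 : -(τ - σ) * m + (τ - π) * q + π * p < 0 := by
    have hpos : 0 < a * b * c * x * y * β := by positivity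
    have h3 : (a⁻¹ + b⁻¹ + c⁻¹ + x⁻¹ + y⁻¹ - 1 - β⁻¹) ^ 2
      - (a⁻¹ ^ 2 + b⁻¹ ^ 2 + c⁻¹ ^ 2 + x⁻¹ ^ 2 + y⁻¹ ^ 2 + 1 + β⁻¹ ^ 2)
      = 2 * (-(τ - σ) * m + (τ - π) * q + π * p) / (a * b * c * x * y * β) := by
      rw [hp, hq, hσ, hτ, hm, hπ]; field_simp; ring
    have h4 := sub_neg.2 h2
    rw [h3, div_neg_iff] at h4
    rcases h4 with h | h <;> linarith [h.1, h.2]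
  have hF : 0 < τ * π - 2 * σ * π + σ * (σ - 1) := by
    rw [hσ, hτ, hπ]; exact symmetric_pos ha hb hc
  have hA1 : 0 < σ - 1 := by linarith
  have hA2 : 0 < τ - σ := by
    rw [hτ, hσ]; nlinarith [mul_pos ha0 (sub_pos.2 hb), mul_pos hb0 (sub_pos.2 hc),
      mul_pos hc0 (sub_pos.2 ha)]
  have hπ0 : 0 < π := by rw [hπ]; positivity
  have hmq : 0 < q - m := by
    have : q - m = β * x * (1 - y) + y * (β - x) := by rw [hq, hm]; ring
    rw [this]
    exact add_pos (mul_pos (mul_pos hβ0 hx) (sub_pos.2 hy1)) (mul_pos hy (sub_pos.2 hxβ))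
  have hm0 : 0 < m := by rw [hm]; positivity
  have hq1 : q < 1 := by
    have : 1 - q = (1 - β) * (x + y) + (1 - x) * (1 - y) := by rw [hq]; ring
    have : 0 < 1 - q := by
      rw [this]
      exact add_pos (mul_pos (sub_pos.2 hβ) (add_pos hx hy))
        (mul_pos (by linarith) (sub_pos.2 hy1))
    linarith
  have key : (τ - σ) * (π - (σ - 1) * m) + q * ((σ - 1) * τ - σ * π) < 0 := by
    linarith [mul_neg_of_pos_of_neg hπ0 c1, mul_neg_of_pos_of_neg hA1 c2]
  have hid : (τ - σ) * (π - (σ - 1) * m) + q * ((σ - 1) * τ - σ * π)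
      = (1 - q) * ((τ - σ) * π) + (τ - σ) * (σ - 1) * (q - m)
        + q * (τ * π - 2 * σ * π + σ * (σ - 1)) := by ring
  have t1 := mul_pos (sub_pos.2 hq1) (mul_pos hA2 hπ0)
  have t2 := mul_pos (mul_pos hA2 hA1) hmq
  have t3 := mul_pos (hm0.trans (sub_pos.1 hmq)) hF
  linarith

/-- The homogeneous form of `normalized_obstruction`. -/
theorem homogeneous_obstruction {a b c x y α β : ℝ} (hα : 0 < α) (ha : α < a) (hb : α < b)
    (hc : α < c) (hx : 0 < x) (hxβ : x < β) (hβ : β < α) (hy : 0 < y) (hyα : y < α)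
    (h1 : (a + b + c + x + y - α - β) ^ 2
      < a ^ 2 + b ^ 2 + c ^ 2 + x ^ 2 + y ^ 2 + α ^ 2 + β ^ 2)
    (h2 : (a⁻¹ + b⁻¹ + c⁻¹ + x⁻¹ + y⁻¹ - α⁻¹ - β⁻¹) ^ 2
      < a⁻¹ ^ 2 + b⁻¹ ^ 2 + c⁻¹ ^ 2 + x⁻¹ ^ 2 + y⁻¹ ^ 2 + α⁻¹ ^ 2 + β⁻¹ ^ 2) : False := by
  have hα2 : 0 < α ^ 2 := by positivity
  refine normalized_obstruction (a := a / α) (b := b / α) (c := c / α) (x := x / α) (y := y / α)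
    (β := β / α) ((one_lt_div hα).2 ha) ((one_lt_div hα).2 hb) ((one_lt_div hα).2 hc)
    (div_pos hx hα) (div_lt_div_of_pos_right hxβ hα) ((div_lt_one hα).2 hβ) (div_pos hy hα)
    ((div_lt_one hα).2 hyα) ?_ ?_
  · have e : (a / α + b / α + c / α + x / α + y / α - 1 - β / α) ^ 2
        - ((a / α) ^ 2 + (b / α) ^ 2 + (c / α) ^ 2 + (x / α) ^ 2 + (y / α) ^ 2 + 1 + (β / α) ^ 2)
        = ((a + b + c + x + y - α - β) ^ 2
          - (a ^ 2 + b ^ 2 + c ^ 2 + x ^ 2 + y ^ 2 + α ^ 2 + β ^ 2)) / α ^ 2 := by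
      field_simp
    exact sub_neg.1 (e ▸ div_neg_of_neg_of_pos (sub_neg.2 h1) hα2)
  · have e : (α * a⁻¹ + α * b⁻¹ + α * c⁻¹ + α * x⁻¹ + α * y⁻¹ - α * α⁻¹ - α * β⁻¹) ^ 2
        - ((α * a⁻¹) ^ 2 + (α * b⁻¹) ^ 2 + (α * c⁻¹) ^ 2 + (α * x⁻¹) ^ 2 + (α * y⁻¹) ^ 2
          + (α * α⁻¹) ^ 2 + (α * β⁻¹) ^ 2)
        = α ^ 2 * ((a⁻¹ + b⁻¹ + c⁻¹ + x⁻¹ + y⁻¹ - α⁻¹ - β⁻¹) ^ 2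
          - (a⁻¹ ^ 2 + b⁻¹ ^ 2 + c⁻¹ ^ 2 + x⁻¹ ^ 2 + y⁻¹ ^ 2 + α⁻¹ ^ 2 + β⁻¹ ^ 2)) := by
      ring
    have h := sub_neg.1 (e ▸ mul_neg_of_pos_of_neg hα2 (sub_neg.2 h2))
    simpa only [inv_div, div_eq_mul_inv α, mul_inv_cancel₀ hα.ne', one_pow] using h

/-- Proposition 4 (2): for `n ≥ 4` and `d = n + 3`, every couple
`(Σ_{2,n,2}, (u,v,3))` with `u + v = n - 2` and `u > 0` is non-realizable. -/
theorem stmt8 (n u v : ℕ) (hn : 4 ≤ n) (huv : u + v = n - 2) (hu : 0 < u) :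
    ¬ RealizesCouple (n + 3) 2 n 2 u v 3 := by
  rintro ⟨P, α, β, γ, hdeg, ⟨-, -, -, -, hpos, hneg⟩, hβ, hβα, -, hγ, hne, hroots, cu, cv, cw⟩
  have hα : 0 < α := hβ.trans hβα
  have hineq := roots_sum_sq_lt hdeg (by omega) (by simp [hroots])
    (by
      intro r hr
      simp only [hroots, Multiset.mem_cons, Multiset.mem_map] at hr
      rcases hr with rfl | rfl | ⟨i, -, rfl⟩
      · exact hα.ne'
      · exact hβ.ne'
      · exact neg_ne_zero.2 (hγ i).ne')
    (hpos _ le_rfl (by omega)) (hneg _ (by omega) (by omega))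
    (hpos 0 (by omega) (by omega)) (hneg 2 (by omega) (by omega))
  simp only [hroots, Multiset.map_cons, Multiset.sum_cons, Multiset.map_map, Function.comp_def,
    inv_neg, neg_sq] at hineq
  change (α + (β + ∑ i, -γ i)) ^ 2 < α ^ 2 + (β ^ 2 + ∑ i, γ i ^ 2) ∧
    (α⁻¹ + (β⁻¹ + ∑ i, -(γ i)⁻¹)) ^ 2 < α⁻¹ ^ 2 + (β⁻¹ ^ 2 + ∑ i, (γ i)⁻¹ ^ 2) at hineq
  simp only [Finset.sum_neg_distrib] at hineq
  obtain ⟨h1, h2⟩ := hineq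
  obtain ⟨a, b, c, hab, hac, hbc, hW⟩ := Finset.card_eq_three.1 cw
  have memW : ∀ i, α < γ i ↔ i = a ∨ i = b ∨ i = c := fun i => by
    have : i ∈ Finset.univ.filter (fun i => α < γ i) ↔ i ∈ ({a, b, c} : Finset _) := by rw [hW]
    simpa using this
  have ha := (memW a).2 (by simp)
  have hb := (memW b).2 (by simp)
  have hc := (memW c).2 (by simp)
  obtain ⟨x, hx⟩ := Finset.card_pos.1 (cu ▸ hu)
  have hxβ : γ x < β := by simpa using hx
  have hxα : γ x < α := hxβ.trans hβα
  obtain ⟨y, hy⟩ : ∃ y, y ∉ ({a, b, c, x} : Finset _) := by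
    by_contra! hcon
    have h4 : ({a, b, c, x} : Finset (Fin (n + 3 - 2))).card ≤ 4 := Finset.card_le_four
    rw [Finset.eq_univ_of_forall hcon, Finset.card_univ, Fintype.card_fin] at h4
    omega
  simp only [Finset.mem_insert, Finset.mem_singleton, not_or] at hy
  obtain ⟨hya, hyb, hyc, hyx⟩ := hy
  have hyα : γ y < α := lt_of_le_of_ne
    (not_lt.1 fun h => by rcases (memW y).1 h with h | h | h <;> contradiction) (hne y).2
  have hxa : x ≠ a := fun h => by subst h; linarith
  have hxb : x ≠ b := fun h => by subst h; linarith
  have hxc : x ≠ c := fun h => by subst h; linarith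
  have split (f : Fin (n + 3 - 2) → ℝ) : ∑ i, f i = f a + f b + f c + f x + f y
      + ∑ i ∈ ({a, b, c, x, y} : Finset _)ᶜ, f i := by
    rw [← Finset.sum_add_sum_compl ({a, b, c, x, y} : Finset _) f,
      Finset.sum_insert (by simp [hab, hac, hxa.symm, Ne.symm hya]),
      Finset.sum_insert (by simp [hbc, hxb.symm, Ne.symm hyb]),
      Finset.sum_insert (by simp [hxc.symm, Ne.symm hyc]),
      Finset.sum_insert (by simp [Ne.symm hyx]), Finset.sum_singleton]
    ring
  rw [split, split] at h1 h2
  have hx1 := inv_strictAnti₀ (hγ x) hxβ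
  have hy1 := inv_strictAnti₀ (hγ y) hyα
  have ia := inv_pos.2 (hγ a)
  have ib := inv_pos.2 (hγ b)
  have ic := inv_pos.2 (hγ c)
  refine homogeneous_obstruction hα ha hb hc (hγ x) hxβ hβα (hγ y) hyα
    (sq_lt_of_add_sum_sq_lt ({a, b, c, x, y} : Finset _)ᶜ γ (fun i _ => (hγ i).le)
      (by linarith [hγ x, hγ y]) ?_)
    (sq_lt_of_add_sum_sq_lt ({a, b, c, x, y} : Finset _)ᶜ (fun i => (γ i)⁻¹)
      (fun i _ => (inv_pos.2 (hγ i)).le) (by linarith) ?_)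
  · linarith
  · linarith
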